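/- Let β > 0 and let η : ℝ → ℝ be a smooth, strictly positive, β-periodic function satisfying the winding constraint ∫₀^β η(u) du = 2π. Then ∫₀^β ( η(u)² − (η′(u)/η(u))² ) du ≤ 4π²/β. Equivalently, the Schwarzian action I_Schwarz = −φ̄_b ∫₀^β (η² − (η′/η)²) du with constant φ̄_b > 0 is bounded below by −4π² φ̄_b / β. -/

import Mathlib

open Real intervalIntegral

/-- If `f` and `g` vanish at `x` and `g` has a nonzero derivative there, then `f ^ 2 / g`
(with value `0` at `x`) is continuous at `x`. -/
lemma continuousAt_sq_div_of_hasDerivAt {f g : ℝ → ℝ} {f' g' x : ℝ} (hf : HasDerivAt f f' x)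
    (hg : HasDerivAt g g' x) (hfx : f x = 0) (hgx : g x = 0) (hg' : g' ≠ 0) :
    ContinuousAt (fun u => f u ^ 2 / g u) x := by
  rw [continuousAt_iff_punctured_nhds]
  have hlim := (hf.continuousAt.tendsto.mono_left nhdsWithin_le_nhds).mul
    ((hasDerivAt_iff_tendsto_slope.mp hf).div (hasDerivAt_iff_tendsto_slope.mp hg) hg')
  simp only [hfx, zero_mul] at hlim
  simp only [hfx, hgx, div_zero]
  refine hlim.congr' ?_
  filter_upwards [self_mem_nhdsWithin] with u hu
  have hux : u - x ≠ 0 := sub_ne_zero.mpr hu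
  simp only [Pi.div_apply, slope_def_field, hfx, hgx, sub_zero]
  rw [div_div_div_cancel_right₀ hux]
  ring

/-- Nonnegativity of the Dirichlet form of the Hill operator attached to a reparametrization with
velocity `η`, evaluated on the half-wave `sin (π (u - a) / β)`. -/
lemma integral_dirichlet_form_nonneg {β a : ℝ} (hβ : 0 < β) {η : ℝ → ℝ} (hη : ContDiff ℝ 1 η)
    (hpos : ∀ u, 0 < η u) (hwind : ∫ u in a..a + β, η u = 2 * π) :
    0 ≤ ∫ u in a..a + β, ((π / β * cos (π / β * (u - a))
      + deriv η u / η u / 2 * sin (π / β * (u - a))) ^ 2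
      - η u ^ 2 / 4 * sin (π / β * (u - a)) ^ 2) := by
  have hcη : Continuous η := hη.continuous
  have hcη' : Continuous (deriv η) := hη.continuous_deriv le_rfl
  set t : ℝ → ℝ := fun u => (∫ s in a..u, η s) / 2 with ht
  have htd : ∀ u, HasDerivAt t (η u / 2) u := fun u =>
    (hcη.integral_hasStrictDerivAt a u).hasDerivAt.div_const 2
  have hta : t a = 0 := by simp [ht]
  have htb : t (a + β) = π := by simp [ht, hwind]
  have hmono : StrictMono t := strictMono_of_deriv_pos fun u => by
    rw [(htd u).deriv]; exact half_pos (hpos u)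
  have hrd : ∀ u, HasDerivAt (fun u => sin (π / β * (u - a)))
      (cos (π / β * (u - a)) * (π / β)) u := fun u => by
    simpa using (((hasDerivAt_id u).sub_const a).const_mul (π / β)).sin
  have hsd : ∀ u, HasDerivAt (fun u => sin (t u)) (cos (t u) * (η u / 2)) u :=
    fun u => (htd u).sin
  have hvb : sin (π / β * (a + β - a)) = 0 := by
    rw [add_sub_cancel_left, div_mul_cancel₀ _ hβ.ne', sin_pi]
  have hs : ∀ u ∈ Set.Ioo a (a + β), sin (t u) ≠ 0 := fun u hu =>
    (sin_pos_of_pos_of_lt_pi (hta ▸ hmono hu.1) (htb ▸ hmono hu.2)).ne'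
  have hquot : ContinuousOn (fun u => sin (π / β * (u - a)) ^ 2 / sin (t u))
      (Set.Icc a (a + β)) := by
    intro u hu
    refine ContinuousAt.continuousWithinAt ?_
    rcases eq_or_lt_of_le hu.1 with rfl | hau
    · refine continuousAt_sq_div_of_hasDerivAt (hrd a) (hsd a) (by simp) (by simp [hta]) ?_
      simp [hta, (hpos a).ne']
    rcases eq_or_lt_of_le hu.2 with rfl | hub
    · refine continuousAt_sq_div_of_hasDerivAt (hrd _) (hsd _) hvb (by simp [htb]) ?_
      simp [htb, (hpos (a + β)).ne']
    · exact ((hrd u).continuousAt.pow 2).div (hsd u).continuousAt (hs u ⟨hau, hub⟩)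
  have key := sub_le_integral_of_hasDeriv_right_of_le
    (g := fun u => η u / 2 * cos (t u) * (sin (π / β * (u - a)) ^ 2 / sin (t u)))
    (g' := fun u => (deriv η u / 2 * cos (t u) + η u / 2 * (-sin (t u) * (η u / 2)))
        * (sin (π / β * (u - a)) ^ 2 / sin (t u))
      + η u / 2 * cos (t u) *
        ((2 * sin (π / β * (u - a)) * (cos (π / β * (u - a)) * (π / β)) * sin (t u)
          - sin (π / β * (u - a)) ^ 2 * (cos (t u) * (η u / 2))) / sin (t u) ^ 2))
    (φ := fun u => (π / β * cos (π / β * (u - a))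
      + deriv η u / η u / 2 * sin (π / β * (u - a))) ^ 2
      - η u ^ 2 / 4 * sin (π / β * (u - a)) ^ 2)
    (a := a) (b := a + β) (by linarith) ?_ ?_ ?_ ?_
  · simpa [hta, htb, hvb] using key
  · refine ContinuousOn.mul (Continuous.continuousOn ?_) hquot
    have : Continuous t := continuous_iff_continuousAt.mpr fun u => (htd u).continuousAt
    fun_prop
  · intro u hu
    have hηd := (hη.differentiable one_ne_zero u).hasDerivAt
    have h2 : HasDerivAt (fun u => sin (π / β * (u - a)) ^ 2)
        (2 * sin (π / β * (u - a)) * (cos (π / β * (u - a)) * (π / β))) u := by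
      simpa using (hrd u).fun_pow 2
    exact (((hηd.div_const 2).mul (htd u).cos).mul (h2.div (hsd u) (hs u hu))).hasDerivWithinAt
  · refine Continuous.integrableOn_Icc ?_
    have : Continuous fun u => deriv η u / η u := hcη'.div hcη fun u => (hpos u).ne'
    fun_prop
  · intro u hu
    have hsu := hs u hu
    have hηu := (hpos u).ne'
    rw [← sub_nonneg]
    refine (sq_nonneg (π / β * cos (π / β * (u - a))
      + deriv η u / η u / 2 * sin (π / β * (u - a))
      - sin (π / β * (u - a)) * η u / 2 * (cos (t u) / sin (t u)))).trans_eq ?_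
    generalize π / β = k
    field_simp
    ring

/-- For `β > 0` and a smooth, strictly positive, `β`-periodic `η` with winding
constraint `∫₀^β η = 2π`, one has `∫₀^β (η² − (η′/η)²) ≤ 4π²/β`.  Equivalently,
the Schwarzian action `I = −φ̄_b ∫₀^β (η² − (η′/η)²)` with `φ̄_b > 0` is bounded
below by `−4π² φ̄_b / β`. -/
theorem schwarzian_bound_general_period
    (β : ℝ) (hβ : 0 < β)
    (η : ℝ → ℝ) (hsmooth : ContDiff ℝ (⊤ : ℕ∞) η) (hpos : ∀ u, 0 < η u)
    (hper : Function.Periodic η β)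
    (hwind : (∫ u in (0:ℝ)..β, η u) = 2 * π) :
    (∫ u in (0:ℝ)..β, (η u ^ 2 - (deriv η u / η u) ^ 2)) ≤ 4 * π ^ 2 / β ∧
      (∀ φb : ℝ, 0 < φb →
        -(4 * π ^ 2 * φb / β)
          ≤ -φb * ∫ u in (0:ℝ)..β, (η u ^ 2 - (deriv η u / η u) ^ 2)) := by
  have hη : ContDiff ℝ 1 η := hsmooth.of_le (by exact_mod_cast le_top)
  have hcη : Continuous η := hη.continuous
  have hch : Continuous fun u => deriv η u / η u :=
    (hη.continuous_deriv le_rfl).div hcη fun u => (hpos u).ne'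
  have hper' : Function.Periodic (deriv η) β := fun u => by
    rw [← deriv_comp_add_const, funext hper]
  have hform : ∀ a, 0 ≤ ∫ u in (0:ℝ)..β, ((π / β * cos (π / β * (u - a))
      + deriv η u / η u / 2 * sin (π / β * (u - a))) ^ 2
      - η u ^ 2 / 4 * sin (π / β * (u - a)) ^ 2) := fun a => by
    have h := integral_dirichlet_form_nonneg (a := a) hβ hη hpos
      (by rw [hper.intervalIntegral_add_eq a 0, zero_add, hwind])
    rwa [Function.Periodic.intervalIntegral_add_eq _ a 0, zero_add] at h
    intro u
    have : π / β * (u + β - a) = π / β * (u - a) + π := by field_simp; ring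
    simp only [this, cos_add_pi, sin_add_pi, hper u, hper' u]
    ring
  have hbound : (∫ u in (0:ℝ)..β, (η u ^ 2 - (deriv η u / η u) ^ 2)) ≤ 4 * π ^ 2 / β := by
    have hsum := add_nonneg (hform 0) (hform (β / 2))
    rw [← integral_add (Continuous.intervalIntegrable (by fun_prop) _ _)
      (Continuous.intervalIntegrable (by fun_prop) _ _)] at hsum
    have hcongr : ∀ u, ((π / β * cos (π / β * (u - 0))
        + deriv η u / η u / 2 * sin (π / β * (u - 0))) ^ 2
        - η u ^ 2 / 4 * sin (π / β * (u - 0)) ^ 2)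
        + ((π / β * cos (π / β * (u - β / 2))
        + deriv η u / η u / 2 * sin (π / β * (u - β / 2))) ^ 2
        - η u ^ 2 / 4 * sin (π / β * (u - β / 2)) ^ 2)
        = (π / β) ^ 2 - 1 / 4 * (η u ^ 2 - (deriv η u / η u) ^ 2) := fun u => by
      have h : π / β * (u - β / 2) = π / β * u - π / 2 := by field_simp
      rw [h, cos_sub_pi_div_two, sin_sub_pi_div_two, sub_zero]
      linear_combination ((π / β) ^ 2 + (deriv η u / η u) ^ 2 / 4 - η u ^ 2 / 4)
        * sin_sq_add_cos_sq (π / β * u)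
    simp only [hcongr] at hsum
    rw [integral_sub (by simp) (Continuous.intervalIntegrable (by fun_prop) _ _),
      integral_const_mul, integral_const, sub_zero, smul_eq_mul] at hsum
    have h : β * (π / β) ^ 2 = π ^ 2 / β := by field_simp
    rw [h] at hsum
    rw [mul_div_assoc]
    linarith
  refine ⟨hbound, fun φb hφ => ?_⟩
  have h := mul_le_mul_of_nonneg_left hbound hφ.le
  have h' : 4 * π ^ 2 * φb / β = φb * (4 * π ^ 2 / β) := by ring
  rw [h', neg_mul]
  exact neg_le_neg h
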